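/- (Core of Theorem A) Assume τ is a regular element, i.e. V_reg^τ ≠ ∅, and let v ∈ V_reg with τ(v) = v. Let c : Ref(W) → ℂ be constant on W-conjugacy classes with c(τsτ⁻¹) = c(s) for all s ∈ Ref(W). Let (ρ, E) be a finite-dimensional complex representation of W and g ∈ GL(E) such that g ∘ ρ(w) ∘ g⁻¹ = ρ(τwτ⁻¹) for all w ∈ W. If the trace of g is nonzero, then there exists v* ∈ V* with v* ∘ τ = v* such that the joint generalized eigenspace E^{c,v,v*} of the Gaudin operators is nonzero. -/

import Mathlib

open Module

noncomputable section

variable {V : Type*} [AddCommGroup V] [Module ℂ V] [FiniteDimensional ℂ V]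

/-- `g` is a reflection: its fixed-point subspace has codimension 1. -/
def IsReflection (g : V ≃ₗ[ℂ] V) : Prop :=
  finrank ℂ (LinearMap.ker ((g : V →ₗ[ℂ] V) - LinearMap.id)) + 1 = finrank ℂ V

/-- The set of points of `V` with trivial stabilizer in `W`. -/
def VReg (W : Subgroup (V ≃ₗ[ℂ] V)) : Set V :=
  {v | ∀ w ∈ W, w v = v → w = 1}

open Classical in
/-- The Gaudin operator `D_y^{c,v}` acting on a `ℂW`-module `E` through the
representation `ρ`. -/
def GaudinOp (W : Subgroup (V ≃ₗ[ℂ] V)) [Fintype W] {E : Type*} [AddCommGroup E]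
    [Module ℂ E] (ρ : Representation ℂ W E) (c : W → ℂ)
    (α : W → Module.Dual ℂ V) (v y : V) : Module.End ℂ E :=
  ∑ s : W, if IsReflection (s : V ≃ₗ[ℂ] V) then
    (LinearMap.det ((s : V ≃ₗ[ℂ] V) : V →ₗ[ℂ] V) * c s * (α s y / α s v)) • ρ s
  else 0

/-- The joint generalized eigenspace `E^{c,v,v*}` of a family of operators for the
system of eigenvalues given by the linear form `ξ`. -/
def jointGenEigenspace {E : Type*} [AddCommGroup E] [Module ℂ E]
    (D : V → Module.End ℂ E) (ξ : Module.Dual ℂ V) : Submodule ℂ E :=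
  ⨅ y : V, LinearMap.ker ((D y - ξ y • (1 : Module.End ℂ E)) ^ finrank ℂ E)

section Auxiliary

variable {U : Type*} [AddCommGroup U] [Module ℂ U]

/-- A finite-order linear automorphism `r` with `(r - 1) ^ 2 = 0` is trivial. -/
theorem eq_one_of_isOfFinOrder_of_unipotent {r : U ≃ₗ[ℂ] U} (hr : IsOfFinOrder r)
    (h : ∀ y, r (r y - y) = r y - y) : r = 1 := by
  obtain ⟨n, hn, hrn⟩ := isOfFinOrder_iff_pow_eq_one.mp hr
  have key : ∀ (k : ℕ) (y : U), (r ^ k) y = y + (k : ℂ) • (r y - y) := by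
    intro k y
    induction k with
    | zero => simp
    | succ k ih =>
      rw [pow_succ', LinearEquiv.mul_apply, ih, map_add, map_smul, h]
      push_cast
      module
  ext y
  have h1 := key n y
  rw [hrn, LinearEquiv.coe_one, id, left_eq_add, smul_eq_zero] at h1
  have h2 : (n : ℂ) ≠ 0 := by exact_mod_cast hn.ne'
  simpa using sub_eq_zero.mp (h1.resolve_left h2)

/-- Two linear forms taking the value `1` at `v` agree as soon as their kernels are nested. -/
theorem dual_eq_of_ker_le {b b' : Dual ℂ U} {v : U} (hb : b v = 1) (hb' : b' v = 1)
    (h : ∀ y, b y = 0 → b' y = 0) : b = b' := by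
  ext y
  have h1 := h (y - b y • v) (by simp [hb])
  rw [map_sub, map_smul, hb', smul_eq_mul, mul_one, sub_eq_zero] at h1
  exact h1.symm

/-- Two reflections generating a finite group whose roots are proportional have the same
hyperplane. -/
theorem reflection_form_eq_of_root_proportional {s t : U ≃ₗ[ℂ] U} {b b' : Dual ℂ U} {v a a' : U}
    (hs : ∀ y, s y = y + b y • a) (ht : ∀ y, t y = y + b' y • a')
    (hb : b v = 1) (hb' : b' v = 1) {k : ℂ} (hk : a' = k • a) (ht1 : t ≠ 1) (hs1 : s ≠ 1)
    (hsfin : IsOfFinOrder s) (hfin : IsOfFinOrder ((t * s)⁻¹ * (s * t))) : b = b' := by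
  subst hk
  have ha : a ≠ 0 := by
    rintro rfl
    exact hs1 (by ext y; simp [hs])
  have hk0 : k ≠ 0 := by
    rintro rfl
    exact ht1 (by ext y; simp [ht])
  have hcomm : (t * s)⁻¹ * (s * t) = 1 := by
    set r := t * s with hr
    have hra : (r⁻¹ * (s * t)) a = a := by
      have : (s * t) a = r a := by
        simp only [hr, LinearEquiv.mul_apply, hs, ht, map_add, map_smul, smul_eq_mul]
        module
      rw [LinearEquiv.mul_apply, this, ← LinearEquiv.mul_apply, inv_mul_cancel]
      rfl
    have hrinv : ∃ m : ℂ, r⁻¹ a = m • a := by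
      have h1 : r a = ((1 + b a) * (1 + k * b' a)) • a := by
        simp only [hr, LinearEquiv.mul_apply, hs, ht, map_add, map_smul, smul_eq_mul]
        module
      have h2 : r⁻¹ (r a) = a := by
        rw [← LinearEquiv.mul_apply, inv_mul_cancel]
        rfl
      rw [h1, map_smul] at h2
      have h3 : (1 + b a) * (1 + k * b' a) ≠ 0 := by
        intro h0
        rw [h0, zero_smul] at h2
        exact ha h2.symm
      exact ⟨((1 + b a) * (1 + k * b' a))⁻¹, by rw [eq_inv_smul_iff₀ h3, h2]⟩
    obtain ⟨m, hm⟩ := hrinv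
    apply eq_one_of_isOfFinOrder_of_unipotent hfin
    intro y
    have h1 : (s * t) y = r y + (k * (b' y * b a - b y * b' a)) • a := by
      simp only [hr, LinearEquiv.mul_apply, hs, ht, map_add, map_smul, smul_eq_mul]
      module
    have h2 : (r⁻¹ * (s * t)) y = y + (k * (b' y * b a - b y * b' a) * m) • a := by
      rw [LinearEquiv.mul_apply, h1, map_add, map_smul, hm, ← LinearEquiv.mul_apply,
        inv_mul_cancel, smul_smul]
      rfl
    rw [h2, add_sub_cancel_left, map_smul, hra]
  have hst : s * t = t * s := by
    rw [inv_mul_eq_one] at hcomm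
    exact hcomm.symm
  have key : ∀ y, b' y * b a = b y * b' a := by
    intro y
    have h1 : s (t y) = t (s y) := by
      rw [← LinearEquiv.mul_apply, hst, LinearEquiv.mul_apply]
    simp only [hs, ht, map_add, map_smul, smul_eq_mul] at h1
    have h2 : (k * (b' y * b a - b y * b' a)) • a = 0 := by
      rw [← sub_eq_zero] at h1
      rw [← h1]
      module
    have h3 := (mul_eq_zero.mp ((smul_eq_zero.mp h2).resolve_right ha)).resolve_left hk0
    exact sub_eq_zero.mp h3
  have hv := key v
  rw [hb, hb', one_mul, one_mul] at hv
  have hba : b a ≠ 0 := by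
    intro h0
    apply hs1
    apply eq_one_of_isOfFinOrder_of_unipotent hsfin
    intro y
    simp [hs, h0]
  ext y
  have h1 := key y
  rw [← hv] at h1
  exact (mul_right_cancel₀ hba h1).symm

/-- A vector fixed by a product of two reflections with distinct hyperplanes lies on both
hyperplanes. -/
theorem forms_eq_zero_of_mul_apply_eq {s t : U ≃ₗ[ℂ] U} {b b' : Dual ℂ U} {v a a' : U}
    (hs : ∀ y, s y = y + b y • a) (ht : ∀ y, t y = y + b' y • a')
    (hb : b v = 1) (hb' : b' v = 1) (ht1 : t ≠ 1) (hs1 : s ≠ 1)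
    (hsfin : IsOfFinOrder s) (hfin : IsOfFinOrder ((t * s)⁻¹ * (s * t))) (hne : b ≠ b')
    {x : U} (hx : s (t x) = x) : b x = 0 ∧ b' x = 0 := by
  have ha : a ≠ 0 := by
    rintro rfl
    exact hs1 (by ext y; simp [hs])
  have hx' : x + b' x • a' + b (t x) • a = x := by
    rw [hs] at hx
    nth_rewrite 1 [ht] at hx
    exact hx
  have h0 : b' x = 0 := by
    by_contra h
    refine hne (reflection_form_eq_of_root_proportional hs ht hb hb'
      (k := -((b' x)⁻¹ * b (t x))) ?_ ht1 hs1 hsfin hfin)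
    have h1 : b' x • a' = -(b (t x) • a) := by
      rw [add_assoc, add_eq_left] at hx'
      exact eq_neg_of_add_eq_zero_left hx'
    rw [neg_smul, mul_smul, ← smul_neg, ← h1, inv_smul_smul₀ h]
  refine ⟨?_, h0⟩
  have htx : t x = x := by simp [ht, h0]
  rw [htx, h0, zero_smul, add_zero, add_eq_left] at hx'
  exact (smul_eq_zero.mp hx').resolve_right ha

/-- A linear form vanishing where two others do is an affine combination of them, when all three
take the value `1` at a common vector. -/
theorem exists_affine_combination {b b' d : Dual ℂ U} {v : U} (hb : b v = 1) (hb' : b' v = 1)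
    (hd : d v = 1) (h : ∀ x, b x = 0 → b' x = 0 → d x = 0) :
    ∃ z : ℂ, d = z • b + (1 - z) • b' := by
  have hmem : d ∈ Submodule.span ℂ (Set.range ![b, b']) := by
    apply mem_span_of_iInf_ker_le_ker
    intro x hx
    simp only [Submodule.mem_iInf, LinearMap.mem_ker, Fin.forall_fin_two] at hx
    exact h x hx.1 hx.2
  simp only [Matrix.range_cons, Matrix.range_empty, Set.union_empty, Set.singleton_union,
    Submodule.mem_span_pair] at hmem
  obtain ⟨z, z', rfl⟩ := hmem
  have h1 : z + z' = 1 := by simpa [hb, hb'] using hd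
  exact ⟨z, by rw [← h1, add_sub_cancel_left]⟩

/-- The sum over the factorizations `s * t = w` of the wedge products of the forms attached to
`s` and `t` vanishes. -/
theorem sum_wedge_eq_zero {G : Type*} [Group G] [DecidableEq G] (R : Finset G)
    (hR : ∀ s ∈ R, ∀ t ∈ R, s * t * s⁻¹ ∈ R) (hR' : ∀ s ∈ R, ∀ t ∈ R, t⁻¹ * s * t ∈ R)
    (a : G → ℂ) (ha : ∀ s ∈ R, ∀ t ∈ R, a (s * t * s⁻¹) = a t) (b : G → Dual ℂ U)
    (hb : ∀ s ∈ R, ∀ t ∈ R, b s ≠ b t → ∀ s' ∈ R, ∀ t' ∈ R, s' * t' = s * t →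
      (∃ z : ℂ, b s' = z • b s + (1 - z) • b t) ∧ ∃ z : ℂ, b t' = z • b s + (1 - z) • b t)
    (y y' : U) (w : G) :
    ∑ p ∈ (R ×ˢ R).filter (fun p => p.1 * p.2 = w),
      a p.1 * a p.2 * (b p.1 y * b p.2 y' - b p.1 y' * b p.2 y) = 0 := by
  by_cases h : ∃ s ∈ R, ∃ t ∈ R, s * t = w ∧ b s ≠ b t
  · obtain ⟨s, hs, t, ht, rfl, hst⟩ := h
    classical
    let z : G → ℂ := fun u =>
      if hu : ∃ z : ℂ, b u = z • b s + (1 - z) • b t then hu.choose else 0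
    have hz : ∀ u, (∃ z : ℂ, b u = z • b s + (1 - z) • b t) →
        b u = z u • b s + (1 - z u) • b t := by
      intro u hu
      simp only [z, dif_pos hu]
      exact hu.choose_spec
    have hurwitz : ∑ p ∈ (R ×ˢ R).filter (fun p => p.1 * p.2 = s * t), a p.1 * a p.2 * z p.1 =
        ∑ p ∈ (R ×ˢ R).filter (fun p => p.1 * p.2 = s * t), a p.1 * a p.2 * z p.2 := by
      refine Finset.sum_nbij' (fun p => (p.1 * p.2 * p.1⁻¹, p.1))
        (fun p => (p.2, p.2⁻¹ * p.1 * p.2)) ?_ ?_ ?_ ?_ ?_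
      · rintro ⟨p, q⟩ h
        simp only [Finset.mem_filter, Finset.mem_product] at h ⊢
        exact ⟨⟨hR _ h.1.1 _ h.1.2, h.1.1⟩, by rw [← h.2]; group⟩
      · rintro ⟨p, q⟩ h
        simp only [Finset.mem_filter, Finset.mem_product] at h ⊢
        exact ⟨⟨h.1.2, hR' _ h.1.1 _ h.1.2⟩, by rw [← h.2]; group⟩
      · rintro ⟨p, q⟩ h
        simp only [Prod.mk.injEq, true_and]
        group
      · rintro ⟨p, q⟩ h
        simp only [Prod.mk.injEq, and_true]
        group
      · rintro ⟨p, q⟩ h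
        simp only [Finset.mem_filter, Finset.mem_product] at h
        simp only [ha _ h.1.1 _ h.1.2]
        ring
    calc _ = ∑ p ∈ (R ×ˢ R).filter (fun p => p.1 * p.2 = s * t),
          (b s y * b t y' - b s y' * b t y) *
            (a p.1 * a p.2 * z p.1 - a p.1 * a p.2 * z p.2) := by
          refine Finset.sum_congr rfl fun p hp => ?_
          simp only [Finset.mem_filter, Finset.mem_product] at hp
          obtain ⟨h1, h2⟩ := hb s hs t ht hst _ hp.1.1 _ hp.1.2 hp.2
          rw [hz _ h1, hz _ h2]
          simp only [LinearMap.add_apply, LinearMap.smul_apply, smul_eq_mul]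
          ring
      _ = 0 := by rw [← Finset.mul_sum, Finset.sum_sub_distrib, hurwitz, sub_self, mul_zero]
  · push Not at h
    refine Finset.sum_eq_zero fun p hp => ?_
    simp only [Finset.mem_filter, Finset.mem_product] at hp
    rw [h _ hp.1.1 _ hp.1.2 hp.2]
    ring

/-- Gaudin-type operators commute. -/
theorem commute_sum_smul_of_wedge {G : Type*} [Group G] {E : Type*} [AddCommGroup E]
    [Module ℂ E] (ρ : Representation ℂ G E) (R : Finset G)
    (hR : ∀ s ∈ R, ∀ t ∈ R, s * t * s⁻¹ ∈ R) (hR' : ∀ s ∈ R, ∀ t ∈ R, t⁻¹ * s * t ∈ R)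
    (a : G → ℂ) (ha : ∀ s ∈ R, ∀ t ∈ R, a (s * t * s⁻¹) = a t) (b : G → Dual ℂ U)
    (hb : ∀ s ∈ R, ∀ t ∈ R, b s ≠ b t → ∀ s' ∈ R, ∀ t' ∈ R, s' * t' = s * t →
      (∃ z : ℂ, b s' = z • b s + (1 - z) • b t) ∧ ∃ z : ℂ, b t' = z • b s + (1 - z) • b t)
    (y y' : U) :
    Commute (∑ s ∈ R, (a s * b s y) • ρ s) (∑ s ∈ R, (a s * b s y') • ρ s) := by
  classical
  rw [commute_iff_eq, ← sub_eq_zero]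
  have hmul : ∀ y y' : U, (∑ s ∈ R, (a s * b s y) • ρ s) * (∑ s ∈ R, (a s * b s y') • ρ s) =
      ∑ p ∈ R ×ˢ R, (a p.1 * a p.2 * (b p.1 y * b p.2 y')) • ρ (p.1 * p.2) := by
    intro y y'
    rw [Finset.sum_mul_sum, Finset.sum_product]
    refine Finset.sum_congr rfl fun s _ => Finset.sum_congr rfl fun t _ => ?_
    rw [smul_mul_smul_comm, map_mul]
    congr 1
    ring
  rw [hmul, hmul, ← Finset.sum_sub_distrib]
  rw [← Finset.sum_fiberwise_of_maps_to (t := (R ×ˢ R).image (fun p => p.1 * p.2))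
    (g := fun p => p.1 * p.2) (fun p hp => Finset.mem_image_of_mem _ hp)]
  refine Finset.sum_eq_zero fun w _ => ?_
  have := sum_wedge_eq_zero R hR hR' a ha b hb y y' w
  calc _ = ∑ p ∈ (R ×ˢ R).filter (fun p => p.1 * p.2 = w),
        (a p.1 * a p.2 * (b p.1 y * b p.2 y' - b p.1 y' * b p.2 y)) • ρ w := by
        refine Finset.sum_congr rfl fun p hp => ?_
        rw [(Finset.mem_filter.mp hp).2, ← sub_smul, ← mul_sub]
    _ = 0 := by rw [← Finset.sum_smul, this, zero_smul]

/-- An automorphism of nonzero trace permuting the joint generalized eigenspaces of a commuting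
family of operators stabilizes a nonzero one. -/
theorem exists_invariant_jointGenEigenspace_ne_bot {E : Type*} [AddCommGroup E] [Module ℂ E]
    [FiniteDimensional ℂ E] (D : U →ₗ[ℂ] End ℂ E) (hD : ∀ y y', Commute (D y) (D y'))
    (τ : U ≃ₗ[ℂ] U) (g : E ≃ₗ[ℂ] E) (hg : ∀ y m, g (D y m) = D (τ y) (g m))
    (htr : LinearMap.trace ℂ E (g : E →ₗ[ℂ] E) ≠ 0) :
    ∃ ξ : Dual ℂ U, ξ ∘ₗ (τ : U →ₗ[ℂ] U) = ξ ∧ jointGenEigenspace D ξ ≠ ⊥ := by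
  classical
  let N : (U → ℂ) → Submodule ℂ E := fun χ => ⨅ y, (D y).maxGenEigenspace (χ y)
  have hN : DirectSum.IsInternal N := by
    rw [DirectSum.isInternal_submodule_iff_iSupIndep_and_iSup_eq_top]
    exact ⟨End.independent_iInf_maxGenEigenspace_of_forall_mapsTo _
        fun i j φ => End.mapsTo_maxGenEigenspace_of_comm (hD j i) φ,
      End.iSup_iInf_maxGenEigenspace_eq_top_of_iSup_maxGenEigenspace_eq_top_of_commute _
        (fun i j _ => hD i j) fun i => End.iSup_maxGenEigenspace_eq_top _⟩
  have hpow : ∀ (y : U) (z : ℂ) (k : ℕ) (m : E),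
      g (((D y - z • (1 : End ℂ E)) ^ k) m) = ((D (τ y) - z • (1 : End ℂ E)) ^ k) (g m) := by
    intro y z k
    induction k with
    | zero => intro m; simp
    | succ k ih =>
      intro m
      rw [pow_succ, pow_succ, End.mul_apply, End.mul_apply, ih]
      simp [hg]
  have hmaps : ∀ χ : U → ℂ, ∀ m ∈ N χ, g m ∈ N (χ ∘ τ.symm) := by
    intro χ m hm
    simp only [N, Submodule.mem_iInf, End.mem_maxGenEigenspace] at hm ⊢
    intro y
    obtain ⟨k, hk⟩ := hm (τ.symm y)
    refine ⟨k, ?_⟩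
    have := hpow (τ.symm y) (χ (τ.symm y)) k m
    rw [hk, map_zero, LinearEquiv.apply_symm_apply] at this
    exact this.symm
  obtain ⟨χ, hχ, hχτ⟩ : ∃ χ, N χ ≠ ⊥ ∧ χ ∘ τ.symm = χ := by
    by_contra! hcon
    apply htr
    let σ : {χ // N χ ≠ ⊥} → {χ // N χ ≠ ⊥} := fun χ => ⟨χ.1 ∘ τ.symm, by
      obtain ⟨m, hm, hm0⟩ := Submodule.exists_mem_ne_zero_of_ne_bot χ.2
      exact (Submodule.ne_bot_iff _).mpr ⟨g m, hmaps _ m hm, by simpa using hm0⟩⟩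
    exact LinearMap.trace_eq_zero_of_mapsTo_ne (DirectSum.isInternal_ne_bot_iff.mpr hN) σ
      (fun χ h => hcon χ.1 χ.2 (congrArg Subtype.val h)) fun χ m hm => hmaps χ.1 m hm
  let ξ : Dual ℂ U :=
    { toFun := χ
      map_add' := End.map_add_of_iInf_genEigenspace_ne_bot_of_commute D χ ⊤ hχ hD
      map_smul' := End.map_smul_of_iInf_genEigenspace_ne_bot D χ ⊤ hχ }
  refine ⟨ξ, ?_, ?_⟩
  · ext y
    have := congrFun hχτ (τ y)
    simpa [ξ] using this.symm
  · convert! hχ using 1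
    simp only [N, jointGenEigenspace, End.maxGenEigenspace_eq_genEigenspace_finrank,
      End.genEigenspace_nat]
    rfl

theorem IsReflection.conj {g : U ≃ₗ[ℂ] U} (hg : IsReflection g) (h : U ≃ₗ[ℂ] U) :
    IsReflection (h * g * h⁻¹) := by
  unfold IsReflection at hg ⊢
  rw [← hg]
  congr 1
  suffices hker : LinearMap.ker (((h * g * h⁻¹ : U ≃ₗ[ℂ] U) : U →ₗ[ℂ] U) - LinearMap.id) =
      (LinearMap.ker ((g : U →ₗ[ℂ] U) - LinearMap.id)).map (h : U →ₗ[ℂ] U) by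
    rw [hker]
    exact LinearEquiv.finrank_map_eq h _
  ext x
  rw [Submodule.mem_map_equiv]
  simp only [LinearMap.mem_ker, LinearMap.sub_apply, LinearMap.id_apply, LinearEquiv.coe_coe,
    LinearEquiv.mul_apply, sub_eq_zero]
  exact h.toEquiv.eq_symm_apply.symm

theorem not_isReflection_one : ¬ IsReflection (1 : U ≃ₗ[ℂ] U) := by
  intro h
  have h0 : ((1 : U ≃ₗ[ℂ] U) : U →ₗ[ℂ] U) - LinearMap.id = 0 := by
    ext x
    simp
  rw [IsReflection, h0, LinearMap.ker_zero, finrank_top] at h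
  omega

theorem det_conj_linearEquiv (g h : U ≃ₗ[ℂ] U) :
    LinearMap.det ((h * g * h⁻¹ : U ≃ₗ[ℂ] U) : U →ₗ[ℂ] U) = LinearMap.det (g : U →ₗ[ℂ] U) :=
  LinearMap.det_conj (g : U →ₗ[ℂ] U) h

end Auxiliary

/-- (Core of Theorem A) If `τ` is regular, fixes `v ∈ V_reg`, stabilizes the class
function `c`, and `g ∈ GL(E)` intertwines the representation `ρ` of `W` with its
`τ`-twist and has nonzero trace, then some `τ`-invariant linear form `v*` yields a
nonzero joint generalized eigenspace `E^{c,v,v*}` of the Gaudin operators. -/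
theorem stmt12 (W : Subgroup (V ≃ₗ[ℂ] V)) [Fintype W]
    (hW : Subgroup.closure {g : V ≃ₗ[ℂ] V | g ∈ W ∧ IsReflection g} = W)
    (τ : V ≃ₗ[ℂ] V) (hτfin : IsOfFinOrder τ)
    (hnorm : ∀ g : V ≃ₗ[ℂ] V, g ∈ W ↔ τ * g * τ⁻¹ ∈ W)
    (hreg : ∃ u ∈ VReg W, τ u = u)
    (v : V) (hv : v ∈ VReg W) (hτv : τ v = v)
    (α : W → Module.Dual ℂ V)
    (hα : ∀ s : W, IsReflection (s : V ≃ₗ[ℂ] V) →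
      LinearMap.ker (α s) = LinearMap.ker (((s : V ≃ₗ[ℂ] V) : V →ₗ[ℂ] V) - LinearMap.id))
    (c : W → ℂ)
    (hc : ∀ s w : W, IsReflection (s : V ≃ₗ[ℂ] V) → c (w * s * w⁻¹) = c s)
    (hcτ : ∀ s u : W, IsReflection (s : V ≃ₗ[ℂ] V) →
      (u : V ≃ₗ[ℂ] V) = τ * (s : V ≃ₗ[ℂ] V) * τ⁻¹ → c u = c s)
    {E : Type*} [AddCommGroup E] [Module ℂ E] [FiniteDimensional ℂ E]
    (ρ : Representation ℂ W E)
    (g : E ≃ₗ[ℂ] E)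
    (hg : ∀ w u : W, (u : V ≃ₗ[ℂ] V) = τ * (w : V ≃ₗ[ℂ] V) * τ⁻¹ →
      (g : E →ₗ[ℂ] E) ∘ₗ ρ w = ρ u ∘ₗ (g : E →ₗ[ℂ] E))
    (htr : LinearMap.trace ℂ E (g : E →ₗ[ℂ] E) ≠ 0) :
    ∃ ξ : Module.Dual ℂ V, ξ ∘ₗ (τ : V →ₗ[ℂ] V) = ξ ∧
      jointGenEigenspace (GaudinOp W ρ c α v) ξ ≠ ⊥ := by
  classical
  let R : Finset W := Finset.univ.filter fun s => IsReflection (s : V ≃ₗ[ℂ] V)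
  let a : W → ℂ := fun s => LinearMap.det ((s : V ≃ₗ[ℂ] V) : V →ₗ[ℂ] V) * c s
  let b : W → Dual ℂ V := fun s => (α s v)⁻¹ • α s
  have memR : ∀ s, s ∈ R ↔ IsReflection (s : V ≃ₗ[ℂ] V) := by simp [R]
  have hker : ∀ s ∈ R, ∀ y, α s y = 0 ↔ (s : V ≃ₗ[ℂ] V) y = y := by
    intro s hs y
    rw [← LinearMap.mem_ker, hα s ((memR s).mp hs)]
    simp [sub_eq_zero]
  have hne : ∀ s ∈ R, (s : V ≃ₗ[ℂ] V) ≠ 1 := by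
    intro s hs h
    rw [memR, h] at hs
    exact not_isReflection_one hs
  have hαv : ∀ s ∈ R, α s v ≠ 0 := fun s hs h =>
    hne s hs (hv _ s.2 ((hker s hs v).mp h))
  have hbv : ∀ s ∈ R, b s v = 1 := fun s hs => by simp [b, hαv s hs]
  have hb0 : ∀ s ∈ R, ∀ y, b s y = 0 ↔ (s : V ≃ₗ[ℂ] V) y = y := fun s hs y => by
    simp [b, hαv s hs, hker s hs]
  have hform : ∀ s ∈ R, ∀ y, (s : V ≃ₗ[ℂ] V) y = y + b s y • ((s : V ≃ₗ[ℂ] V) v - v) := by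
    intro s hs y
    have h1 := (hb0 s hs (y - b s y • v)).mp (by simp [hbv s hs])
    rw [map_sub, map_smul, sub_eq_sub_iff_add_eq_add] at h1
    rw [smul_sub, ← add_sub_assoc, ← h1, add_sub_cancel_right]
  have hfin : ∀ s : W, IsOfFinOrder (s : V ≃ₗ[ℂ] V) := fun s =>
    Submonoid.isOfFinOrder_coe.mpr (isOfFinOrder_of_finite s)
  have hfix : ∀ s ∈ R, ∀ t ∈ R, b s ≠ b t → ∀ x,
      (s : V ≃ₗ[ℂ] V) ((t : V ≃ₗ[ℂ] V) x) = x → b s x = 0 ∧ b t x = 0 := fun s hs t ht hst x hx =>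
    forms_eq_zero_of_mul_apply_eq (hform s hs) (hform t ht) (hbv s hs) (hbv t ht) (hne t ht)
      (hne s hs) (hfin s) (hfin ((t * s)⁻¹ * (s * t))) hst hx
  have hD : ∀ y, GaudinOp W ρ c α v y = ∑ s ∈ R, (a s * b s y) • ρ s := by
    intro y
    rw [GaudinOp, Finset.sum_filter]
    refine Finset.sum_congr rfl fun s _ => ?_
    simp only [a, b, LinearMap.smul_apply, smul_eq_mul, div_eq_inv_mul]
  have hconj : ∀ s ∈ R, ∀ t : W, t * s * t⁻¹ ∈ R := fun s hs t =>
    (memR _).mpr (((memR s).mp hs).conj t)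
  have hcomm : ∀ y y', Commute (GaudinOp W ρ c α v y) (GaudinOp W ρ c α v y') := by
    intro y y'
    rw [hD, hD]
    refine commute_sum_smul_of_wedge ρ R (fun s _ t ht => hconj t ht s)
      (fun s hs t _ => by simpa only [inv_inv] using hconj s hs t⁻¹) a ?_ b ?_ y y'
    · intro s _ t ht
      simp only [a]
      rw [hc t s ((memR t).mp ht)]
      congr 1
      exact det_conj_linearEquiv _ _
    · intro s hs t ht hst s' hs' t' ht' hw
      have happ : ∀ x, (s' : V ≃ₗ[ℂ] V) ((t' : V ≃ₗ[ℂ] V) x) = s.1 (t.1 x) := fun x =>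
        LinearEquiv.congr_fun (congrArg Subtype.val hw) x
      have hle : ∀ x, b s x = 0 → b t x = 0 → (s' : V ≃ₗ[ℂ] V) ((t' : V ≃ₗ[ℂ] V) x) = x := by
        intro x h1 h2
        rw [happ, (hb0 t ht x).mp h2, (hb0 s hs x).mp h1]
      have hst' : b s' ≠ b t' := by
        intro h
        have hle' : ∀ x, b s' x = 0 → b s x = 0 ∧ b t x = 0 := fun x hx =>
          hfix s hs t ht hst x (by
            rw [← happ, (hb0 t' ht' x).mp (h ▸ hx), (hb0 s' hs' x).mp hx])
        apply hst
        rw [← dual_eq_of_ker_le (hbv s' hs') (hbv s hs) fun x hx => (hle' x hx).1,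
          ← dual_eq_of_ker_le (hbv s' hs') (hbv t ht) fun x hx => (hle' x hx).2]
      have hzero : ∀ x, b s x = 0 → b t x = 0 → b s' x = 0 ∧ b t' x = 0 := fun x h1 h2 =>
        hfix s' hs' t' ht' hst' x (hle x h1 h2)
      exact ⟨exists_affine_combination (hbv s hs) (hbv t ht) (hbv s' hs')
          fun x h1 h2 => (hzero x h1 h2).1,
        exists_affine_combination (hbv s hs) (hbv t ht) (hbv t' ht')
          fun x h1 h2 => (hzero x h1 h2).2⟩
  let θ : W → W := fun s => ⟨τ * s * τ⁻¹, (hnorm s).mp s.2⟩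
  let θ' : W → W := fun s => ⟨τ⁻¹ * s * τ, (hnorm _).mpr (by simp [mul_assoc])⟩
  have hθR : ∀ s ∈ R, θ s ∈ R := fun s hs => (memR _).mpr (((memR s).mp hs).conj τ)
  have hequiv : ∀ y m, g (GaudinOp W ρ c α v y m) = GaudinOp W ρ c α v (τ y) (g m) := by
    intro y m
    rw [hD, hD, LinearMap.sum_apply, LinearMap.sum_apply, map_sum]
    refine Finset.sum_nbij' θ θ' hθR ?_ ?_ ?_ ?_
    · intro s hs
      rw [memR] at hs ⊢
      simpa [θ'] using hs.conj τ⁻¹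
    · intro s _
      ext1
      simp [θ, θ', mul_assoc]
    · intro s _
      ext1
      simp [θ, θ', mul_assoc]
    · intro s hs
      have h1 : a (θ s) = a s := by
        simp only [a]
        rw [hcτ s (θ s) ((memR s).mp hs) rfl]
        congr 1
        exact det_conj_linearEquiv _ _
      have h2 : b s = b (θ s) ∘ₗ (τ : V →ₗ[ℂ] V) := by
        refine dual_eq_of_ker_le (hbv s hs) ?_ ?_
        · simp [hτv, hbv _ (hθR s hs)]
        · intro x hx
          rw [hb0 s hs] at hx
          refine (hb0 _ (hθR s hs) _).mpr ?_
          have : τ⁻¹ (τ x) = x := τ.symm_apply_apply x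
          simp only [θ, LinearEquiv.mul_apply, LinearEquiv.coe_coe]
          rw [this, hx]
      have h3 := LinearMap.congr_fun (hg s (θ s) rfl) m
      simp only [LinearMap.comp_apply, LinearEquiv.coe_coe] at h3
      have h4 : b s y = b (θ s) (τ y) := LinearMap.congr_fun h2 y
      rw [h1, ← h4]
      exact (map_smul g _ _).trans (congrArg _ h3)
  let D : V →ₗ[ℂ] End ℂ E :=
    { toFun := GaudinOp W ρ c α v
      map_add' := fun y y' => by
        simp only [hD, map_add, mul_add, add_smul, Finset.sum_add_distrib]
      map_smul' := fun z y => by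
        simp only [hD, map_smul, smul_eq_mul, RingHom.id_apply, Finset.smul_sum, smul_smul,
          mul_left_comm] }
  exact exists_invariant_jointGenEigenspace_ne_bot D hcomm τ g hequiv htr
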